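/- arXiv:2502.03331 — 2 statements merged into one kernel-verified Lean document; each statement's English description precedes it below -/
import Mathlib

section
/- Let F₂ be the free group on generators a and b, let S ⊆ F₂ be the set of elements whose reduced word is empty or ends in b or b⁻¹, and let H = ℓ²(S) with orthonormal basis (δ_g)_{g∈S}. Then: (i) for every g ∈ S with g ≠ e, the element a·g lies in S ∖ {e}, and for every g ∈ S the element b·g lies in S; and (ii) for every θ ∈ ℂ with |θ| = 1, there exists a unique group homomorphism U_θ from F₂ to the group of unitary operators on H such that U_θ(a)δ_e = θ·δ_e, U_θ(a)δ_g = δ_{a·g} for all g ∈ S ∖ {e}, and U_θ(b)δ_g = δ_{b·g} for all g ∈ S. -/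
open scoped ENNReal

/-- The free group on two generators. -/
abbrev F2 : Type := FreeGroup (Fin 2)

/-- The generator `a` of `F₂`. -/
def genA : F2 := FreeGroup.of 0

/-- The generator `b` of `F₂`. -/
def genB : F2 := FreeGroup.of 1

/-- `S = G_b′`: the set of elements of `F₂` whose reduced word is empty
or ends in `b` or `b⁻¹`. -/
def SetS : Set F2 := {g : F2 | ∀ l ∈ g.toWord.getLast?, l.1 = (1 : Fin 2)}

/-- `H = ℓ²(S)`. -/
noncomputable abbrev HS : Type := lp (fun _ : SetS => ℂ) 2

/-- `δ_g`, the indicator basis vector of `g ∈ S` in `ℓ²(S)`. -/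
noncomputable def deltaS (g : SetS) : HS :=
  letI : DecidableEq ↥SetS := Classical.decEq _
  lp.single 2 g 1

theorem mk_singleton_mul_mem_SetS {x : Fin 2 × Bool} {g : F2} (hg : g ∈ SetS)
    (h : g ≠ 1 ∨ x.1 = 1) : FreeGroup.mk [x] * g ∈ SetS := by
  have hw : (FreeGroup.mk [x] * g).toWord = FreeGroup.reduce (x :: g.toWord) := by
    rw [FreeGroup.toWord_mul, FreeGroup.toWord_mk, FreeGroup.reduce_singleton,
      List.singleton_append]
  rw [ne_eq, ← FreeGroup.toWord_eq_nil_iff] at h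
  simp only [SetS, Set.mem_ofPred_eq] at hg ⊢
  rw [hw, FreeGroup.reduce.cons, FreeGroup.reduce_toWord]
  cases hL : g.toWord with
  | nil => simpa [hL] using h
  | cons y L =>
    rw [hL] at hg
    dsimp only
    split_ifs
    · cases L with
      | nil => simp
      | cons z M => simpa [List.getLast?_cons_cons] using hg
    · simpa [List.getLast?_cons_cons] using hg

theorem mk_singleton_mul_ne_one {x : Fin 2 × Bool} (hx : x.1 ≠ 1) {g : F2} (hg : g ∈ SetS) :
    FreeGroup.mk [x] * g ≠ 1 := by
  intro h
  rw [mul_eq_one_iff_inv_eq] at h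
  subst h
  have h0 : x.1 = 0 := by omega
  simp [SetS, FreeGroup.invRev, h0] at hg

theorem genA_inv_eq : genA⁻¹ = FreeGroup.mk [(0, false)] := by
  simp [genA, FreeGroup.of, FreeGroup.inv_mk, FreeGroup.invRev]

theorem genB_inv_eq : genB⁻¹ = FreeGroup.mk [(1, false)] := by
  simp [genB, FreeGroup.of, FreeGroup.inv_mk, FreeGroup.invRev]

theorem genA_mul_mem {g : F2} (hg : g ∈ SetS) (h : g ≠ 1) : genA * g ∈ SetS :=
  mk_singleton_mul_mem_SetS hg (Or.inl h)

theorem genA_mul_ne_one {g : F2} (hg : g ∈ SetS) : genA * g ≠ 1 :=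
  mk_singleton_mul_ne_one (by simp) hg

theorem genA_inv_mul_mem {g : F2} (hg : g ∈ SetS) (h : g ≠ 1) : genA⁻¹ * g ∈ SetS :=
  genA_inv_eq ▸ mk_singleton_mul_mem_SetS hg (Or.inl h)

theorem genA_inv_mul_ne_one {g : F2} (hg : g ∈ SetS) : genA⁻¹ * g ≠ 1 :=
  genA_inv_eq ▸ mk_singleton_mul_ne_one (by simp) hg

theorem genB_mul_mem {g : F2} (hg : g ∈ SetS) : genB * g ∈ SetS :=
  mk_singleton_mul_mem_SetS hg (Or.inr rfl)

theorem genB_inv_mul_mem {g : F2} (hg : g ∈ SetS) : genB⁻¹ * g ∈ SetS :=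
  genB_inv_eq ▸ mk_singleton_mul_mem_SetS hg (Or.inr rfl)

/-- The permutation of `S` fixing `e` and acting as left multiplication by `a` elsewhere. -/
def permA : Equiv.Perm SetS where
  toFun g := if h : (g : F2) = 1 then g else ⟨genA * g, genA_mul_mem g.2 h⟩
  invFun g := if h : (g : F2) = 1 then g else ⟨genA⁻¹ * g, genA_inv_mul_mem g.2 h⟩
  left_inv g := by
    by_cases h : (g : F2) = 1
    · simp [h]
    · simp [h, genA_mul_ne_one g.2]
  right_inv g := by
    by_cases h : (g : F2) = 1
    · simp [h]
    · simp [h, genA_inv_mul_ne_one g.2]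

/-- Left multiplication by `b` as a permutation of `S`. -/
def permB : Equiv.Perm SetS where
  toFun g := ⟨genB * g, genB_mul_mem g.2⟩
  invFun g := ⟨genB⁻¹ * g, genB_inv_mul_mem g.2⟩
  left_inv g := by simp
  right_inv g := by simp

/-- The Hilbert basis `(δ_g)_{g ∈ S}` of `ℓ²(S)`. -/
noncomputable def deltaBasis : HilbertBasis SetS ℂ HS :=
  HilbertBasis.ofRepr (LinearIsometryEquiv.refl ℂ HS)

theorem HilbertBasis.repr_symm_deltaS (v : HilbertBasis SetS ℂ HS) (g : SetS) :
    v.repr.symm (deltaS g) = v g := by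
  classical
  rw [← v.repr_symm_single g, deltaS]
  congr!

theorem coe_deltaBasis : ⇑deltaBasis = deltaS :=
  funext fun g => (deltaBasis.repr_symm_deltaS g).symm

theorem orthonormal_deltaS : Orthonormal ℂ deltaS :=
  coe_deltaBasis ▸ deltaBasis.orthonormal

theorem LinearIsometryEquiv.ext_deltaS {V W : HS ≃ₗᵢ[ℂ] HS}
    (h : ∀ g, V (deltaS g) = W (deltaS g)) : V = W := by
  have hVW : (V : HS →L[ℂ] HS) = W := by
    refine ContinuousLinearMap.ext_on
      (Submodule.dense_iff_topologicalClosure_eq_top.mpr deltaBasis.dense_span) ?_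
    rintro _ ⟨g, rfl⟩
    simpa [coe_deltaBasis] using h g
  ext1 x
  exact congrArg (fun T : HS →L[ℂ] HS => T x) hVW

/-- Monomial unitaries of `ℓ²(S)`: permute the basis and multiply by phases. -/
theorem exists_monomial_unitary (σ : Equiv.Perm SetS) (c : SetS → ℂ) (hc : ∀ g, ‖c g‖ = 1) :
    ∃ V : HS ≃ₗᵢ[ℂ] HS, ∀ g, V (deltaS g) = c g • deltaS (σ g) := by
  have hv : Orthonormal ℂ fun g => c g • deltaS (σ g) := by
    refine ⟨fun g => ?_, fun g h hgh => ?_⟩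
    · rw [norm_smul, hc, orthonormal_deltaS.norm_eq_one, one_mul]
    · dsimp only
      rw [inner_smul_left, inner_smul_right,
        orthonormal_deltaS.inner_eq_zero (σ.injective.ne hgh)]
      simp
  have hspan : ⊤ ≤ (Submodule.span ℂ
      (Set.range fun g => c g • deltaS (σ g))).topologicalClosure := by
    rw [← deltaBasis.dense_span, coe_deltaBasis]
    refine Submodule.topologicalClosure_mono (Submodule.span_le.mpr ?_)
    rintro _ ⟨g, rfl⟩
    have hne : c (σ.symm g) ≠ 0 := norm_ne_zero_iff.mp (by simp [hc])
    have hmem := Submodule.smul_mem _ (c (σ.symm g))⁻¹ (Submodule.subset_span (R := ℂ)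
      (Set.mem_range_self (f := fun g => c g • deltaS (σ g)) (σ.symm g)))
    simpa [smul_smul, hne] using hmem
  refine ⟨(HilbertBasis.mk hv hspan).repr.symm, fun g => ?_⟩
  rw [HilbertBasis.repr_symm_deltaS, HilbertBasis.coe_mk]

/-- Yoshizawa's representations `U_θ` of `F₂` on `ℓ²(S)`: left translation by `a` and `b`
on the basis `(δ_g)_{g ∈ S}`, twisted by `U_θ(a)δ_e = θδ_e`; they exist and are unique. -/
theorem yoshizawa_representations_exist_unique :
    -- (i) `S` is preserved by the prescribed actions
    (∀ g ∈ SetS, g ≠ 1 → genA * g ∈ SetS ∧ genA * g ≠ 1) ∧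
    (∀ g ∈ SetS, genB * g ∈ SetS) ∧
    -- (ii) existence and uniqueness of `U_θ`
    (∀ θ : ℂ, ‖θ‖ = 1 →
      ∃! U : F2 →* (HS ≃ₗᵢ[ℂ] HS),
        (∀ g : SetS, (g : F2) = 1 → U genA (deltaS g) = θ • deltaS g) ∧
        (∀ g h : SetS, (g : F2) ≠ 1 → (h : F2) = genA * g →
          U genA (deltaS g) = deltaS h) ∧
        (∀ g h : SetS, (h : F2) = genB * g → U genB (deltaS g) = deltaS h)) := by
  refine ⟨fun g hg h => ⟨genA_mul_mem hg h, genA_mul_ne_one hg⟩, fun g => genB_mul_mem, ?_⟩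
  intro θ hθ
  obtain ⟨A, hA⟩ := exists_monomial_unitary permA (fun g => if (g : F2) = 1 then θ else 1)
    (fun g => by split_ifs <;> simp [hθ])
  obtain ⟨B, hB⟩ := exists_monomial_unitary permB (fun _ => 1) (by simp)
  refine ⟨FreeGroup.lift ![A, B], ⟨fun g hg => ?_, fun g h hg hh => ?_, fun g h hh => ?_⟩, ?_⟩
  · simp [genA, hA, hg, permA]
  · have hσ : permA g = h := Subtype.ext (by simp [permA, hg, hh])
    simp [genA, hA, hg, hσ]
  · have hσ : permB g = h := Subtype.ext (by simp [permB, hh])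
    simp [genB, hB, hσ]
  · rintro U ⟨hU₁, hUa, hUb⟩
    refine FreeGroup.ext_hom _ _ fun i => LinearIsometryEquiv.ext_deltaS fun g => ?_
    fin_cases i
    · change U genA _ = _
      by_cases hg : (g : F2) = 1
      · simp [hU₁ g hg, hA, hg, permA]
      · rw [hUa g ⟨_, genA_mul_mem g.2 hg⟩ hg rfl]
        simp [hA, hg, permA]
    · change U genB _ = _
      rw [hUb g ⟨_, genB_mul_mem g.2⟩ rfl]
      simp [hB, permB]
end

section
/- Let F₂ be the free group on generators a and b, S ⊆ F₂ the set of elements whose reduced word is empty or ends in b or b⁻¹, H = ℓ²(S), and θ ∈ ℂ with |θ| = 1. Let U_θ be a group homomorphism from F₂ to the unitary operators on H satisfying U_θ(a)δ_e = θ·δ_e, U_θ(a)δ_g = δ_{a·g} for g ∈ S ∖ {e}, and U_θ(b)δ_g = δ_{b·g} for g ∈ S. Then U_θ is irreducible: every closed subspace V ⊆ H with U_θ(g)V ⊆ V for all g ∈ F₂ is either {0} or H. -/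
open scoped ENNReal

theorem deltaS_eq_single [DecidableEq SetS] (g : SetS) :
    deltaS g = lp.single 2 g (1 : ℂ) := by
  unfold deltaS
  congr!

theorem inner_deltaS (g : SetS) (v : HS) : inner ℂ (deltaS g) v = v g := by
  rw [deltaS_eq_single, lp.inner_single_left]
  simp

theorem deltaS_apply_ne {g h : SetS} (hgh : h ≠ g) : deltaS g h = 0 := by
  rw [deltaS_eq_single, lp.single_apply, Pi.single_eq_of_ne hgh]

theorem deltaS_apply_self (g : SetS) : deltaS g g = 1 := by
  rw [deltaS_eq_single, lp.single_apply, Pi.single_eq_same]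

theorem one_mem_SetS : (1 : F2) ∈ SetS := by
  simp [SetS]

theorem List.getLast?_mem_cons {α : Type*} {x y : α} {L : List α} (h : y ∈ L.getLast?) :
    y ∈ (x :: L).getLast? := by
  cases L <;> simp_all [List.getLast?_cons_cons]

theorem genA_mul_mem_SetS {g : F2} (hg : g ∈ SetS) (hg1 : g ≠ 1) : genA * g ∈ SetS := by
  have hw : (genA * g).toWord = FreeGroup.reduce ((0, true) :: g.toWord) := by
    rw [genA, FreeGroup.toWord_mul, FreeGroup.toWord_of, List.singleton_append]
  intro l hl
  rw [hw, FreeGroup.reduce.cons, FreeGroup.reduce_toWord] at hl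
  have hne : g.toWord ≠ [] := mt FreeGroup.toWord_eq_nil_iff.1 hg1
  apply hg l
  cases h : g.toWord with
  | nil => exact absurd h hne
  | cons hd tl =>
    rw [h] at hl
    dsimp only at hl
    split_ifs at hl
    · exact List.getLast?_mem_cons hl
    · rwa [List.getLast?_cons_cons] at hl

theorem genA_pow_mul_mem_SetS {g : F2} (hg : g ∈ SetS) (hg1 : g ≠ 1) (n : ℕ) :
    genA ^ n * g ∈ SetS ∧ genA ^ n * g ≠ 1 := by
  induction n with
  | zero => simpa using ⟨hg, hg1⟩
  | succ n ih =>
    rw [pow_succ', mul_assoc]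
    exact ⟨genA_mul_mem_SetS ih.1 ih.2, genA_mul_ne_one ih.1⟩

theorem genA_pow_injective : Function.Injective (fun n : ℕ => genA ^ n) := by
  intro m n h
  have := congrArg (fun g : F2 => g.toWord.length) h
  simpa [genA, FreeGroup.toWord_of_pow] using this

/-- An `ℓ²` function whose modulus is constant along an injective sequence vanishes there. -/
theorem lp_apply_eq_zero_of_norm_const {ι : Type*} (v : lp (fun _ : ι => ℂ) 2) {f : ℕ → ι}
    (hf : Function.Injective f) (hv : ∀ n, ‖v (f (n + 1))‖ = ‖v (f n)‖) : v (f 0) = 0 := by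
  have hc : ∀ n, ‖v (f n)‖ = ‖v (f 0)‖ := by
    intro n
    induction n with
    | zero => rfl
    | succ n ih => rw [hv, ih]
  have hs := ((lp.memℓp v).summable (by simp)).comp_injective hf
  simp only [Function.comp_def, hc] at hs
  simpa using (summable_const_iff _).1 hs

/-- The `θ`-eigenspace of the operator assigned to `a` is spanned by `δ_e`. -/
theorem eq_smul_deltaS_one_of_eigenvector {θ : ℂ} (hθ : ‖θ‖ = 1) (T : HS ≃ₗᵢ[ℂ] HS)
    (hT : ∀ g h : SetS, (g : F2) ≠ 1 → (h : F2) = genA * g → T (deltaS g) = deltaS h)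
    {v : HS} (hv : T v = θ • v) :
    v = v ⟨1, one_mem_SetS⟩ • deltaS ⟨1, one_mem_SetS⟩ := by
  have hstep : ∀ g h : SetS, (g : F2) ≠ 1 → (h : F2) = genA * g → ‖v h‖ = ‖v g‖ := by
    intro g h hg hh
    have key : inner ℂ (deltaS h) (θ • v) = inner ℂ (deltaS g) v := by
      rw [← hv, ← hT g h hg hh, LinearIsometryEquiv.inner_map_map]
    rw [inner_smul_right, inner_deltaS, inner_deltaS] at key
    rw [← key, norm_mul, hθ, one_mul]
  ext g
  rw [lp.coeFn_smul, Pi.smul_apply, smul_eq_mul]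
  by_cases hg : g = ⟨1, one_mem_SetS⟩
  · rw [hg, deltaS_apply_self, mul_one]
  · rw [deltaS_apply_ne hg, mul_zero]
    have hg1 : (g : F2) ≠ 1 := fun h => hg (Subtype.ext h)
    let f : ℕ → SetS := fun n => ⟨genA ^ n * g, (genA_pow_mul_mem_SetS g.2 hg1 n).1⟩
    have hf : Function.Injective f := fun m n h =>
      genA_pow_injective (mul_right_cancel (congrArg Subtype.val h))
    have h0 : f 0 = g := Subtype.ext (by simp [f])
    rw [← h0]
    refine lp_apply_eq_zero_of_norm_const v hf fun n => hstep _ _ ?_ ?_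
    · exact (genA_pow_mul_mem_SetS g.2 hg1 n).2
    · simp only [f, pow_succ', mul_assoc]

/-- `δ_e` is a cyclic vector. -/
theorem deltaS_mem_of_deltaS_one_mem (U : F2 →* (HS ≃ₗᵢ[ℂ] HS))
    (hUa : ∀ g h : SetS, (g : F2) ≠ 1 → (h : F2) = genA * g →
      U genA (deltaS g) = deltaS h)
    (hUb : ∀ g h : SetS, (h : F2) = genB * g → U genB (deltaS g) = deltaS h)
    {V : Submodule ℂ HS} (hV : ∀ g : F2, ∀ v ∈ V, U g v ∈ V)
    (h1 : deltaS ⟨1, one_mem_SetS⟩ ∈ V) (g : SetS) : deltaS g ∈ V := by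
  have hinv : ∀ (x : F2) (v w : HS), U x v = w → w ∈ V → v ∈ V := by
    rintro x v w rfl hw
    have := hV x⁻¹ _ hw
    rwa [map_inv, LinearIsometryEquiv.inv_def, LinearIsometryEquiv.symm_apply_apply] at this
  suffices H : ∀ (L : List (Fin 2 × Bool)) (g : SetS), (g : F2).toWord = L → deltaS g ∈ V from
    H _ g rfl
  intro L
  induction L with
  | nil =>
    intro g hg
    rwa [show g = ⟨1, one_mem_SetS⟩ from Subtype.ext (FreeGroup.toWord_eq_nil_iff.1 hg)]
  | cons x L ih =>
    intro g hg
    have hL : (FreeGroup.mk L).toWord = L := by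
      rw [FreeGroup.toWord_mk]
      have hred : FreeGroup.IsReduced (x :: L) := hg ▸ FreeGroup.isReduced_toWord
      exact (hred.infix (List.suffix_cons x L).isInfix).reduce_eq
    have hmem : FreeGroup.mk L ∈ SetS := by
      intro l hl
      rw [hL] at hl
      exact g.2 l (hg ▸ List.getLast?_mem_cons hl)
    have hgx : (g : F2) = FreeGroup.mk [x] * FreeGroup.mk L := by
      rw [FreeGroup.mul_mk, List.singleton_append, ← hg, FreeGroup.mk_toWord]
    have hg1 : (g : F2) ≠ 1 := fun h => by simp [h] at hg
    have ihL := ih ⟨_, hmem⟩ hL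
    have hL1 : x.1 = 0 → FreeGroup.mk L ≠ 1 := by
      intro hx h
      rw [h, FreeGroup.toWord_one] at hL
      have := g.2 x (by rw [hg, ← hL]; simp)
      simp [hx] at this
    obtain ⟨i, s⟩ := x
    fin_cases i <;> cases s
    · refine hinv genA _ _ (hUa g ⟨_, hmem⟩ hg1 ?_) ihL
      rw [hgx]
      exact (mul_inv_cancel_left genA _).symm
    · rw [← hUa ⟨_, hmem⟩ g (hL1 rfl) hgx]
      exact hV _ _ ihL
    · refine hinv genB _ _ (hUb g ⟨_, hmem⟩ ?_) ihL
      rw [hgx]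
      exact (mul_inv_cancel_left genB _).symm
    · rw [← hUb ⟨_, hmem⟩ g hgx]
      exact hV _ _ ihL

theorem eq_bot_of_forall_deltaS_mem_orthogonal {V : Submodule ℂ HS}
    (h : ∀ g, deltaS g ∈ Vᗮ) : V = ⊥ := by
  rw [Submodule.eq_bot_iff]
  intro v hv
  ext g
  rw [← inner_deltaS]
  exact Submodule.inner_left_of_mem_orthogonal hv (h g)

/-- Yoshizawa's representation `U_θ` of `F₂` on `ℓ²(S)` is irreducible: every closed
invariant subspace is `{0}` or the whole space. -/
theorem yoshizawa_representation_irreducible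
    (θ : ℂ) (hθ : ‖θ‖ = 1) (U : F2 →* (HS ≃ₗᵢ[ℂ] HS))
    (hUa1 : ∀ g : SetS, (g : F2) = 1 → U genA (deltaS g) = θ • deltaS g)
    (hUa : ∀ g h : SetS, (g : F2) ≠ 1 → (h : F2) = genA * g →
      U genA (deltaS g) = deltaS h)
    (hUb : ∀ g h : SetS, (h : F2) = genB * g → U genB (deltaS g) = deltaS h) :
    ∀ V : Submodule ℂ HS, IsClosed (V : Set HS) →
      (∀ g : F2, ∀ v ∈ V, U g v ∈ V) → V = ⊥ ∨ V = ⊤ := by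
  intro V hVc hV
  have : CompleteSpace V := hVc.completeSpace_coe
  have hVo : ∀ g : F2, ∀ w ∈ Vᗮ, U g w ∈ Vᗮ := by
    intro g w hw v hv
    rw [← LinearIsometryEquiv.inner_map_map (U g⁻¹), map_inv U g, LinearIsometryEquiv.inv_def,
      LinearIsometryEquiv.symm_apply_apply, ← LinearIsometryEquiv.inv_def, ← map_inv U g]
    exact hw _ (hV _ _ hv)
  have htop : deltaS ⟨1, one_mem_SetS⟩ ∈ V → V = ⊤ := by
    intro h
    rw [← Submodule.orthogonal_eq_bot_iff]
    exact eq_bot_of_forall_deltaS_mem_orthogonal fun g =>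
      V.le_orthogonal_orthogonal (deltaS_mem_of_deltaS_one_mem U hUa hUb hV h g)
  have hbot : deltaS ⟨1, one_mem_SetS⟩ ∈ Vᗮ → V = ⊥ := fun h =>
    eq_bot_of_forall_deltaS_mem_orthogonal (deltaS_mem_of_deltaS_one_mem U hUa hUb hVo h)
  obtain ⟨v, hv, w, hw, hvw⟩ := V.exists_add_mem_mem_orthogonal (deltaS ⟨1, one_mem_SetS⟩)
  have hU := hUa1 ⟨1, one_mem_SetS⟩ rfl
  rw [hvw, map_add, smul_add] at hU
  have hdiff : U genA v - θ • v = θ • w - U genA w := by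
    rw [sub_eq_sub_iff_add_eq_add, hU, add_comm]
  have hzero : U genA v - θ • v = 0 := by
    refine Submodule.disjoint_def.1 V.orthogonal_disjoint _
      (V.sub_mem (hV _ _ hv) (V.smul_mem _ hv)) ?_
    rw [hdiff]
    exact Submodule.sub_mem _ (Submodule.smul_mem _ _ hw) (hVo _ _ hw)
  have hveq := eq_smul_deltaS_one_of_eigenvector hθ (U genA) hUa (sub_eq_zero.1 hzero)
  by_cases hc : v ⟨1, one_mem_SetS⟩ = 0
  · left
    rw [hc, zero_smul] at hveq
    rw [hveq, zero_add] at hvw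
    exact hbot (hvw ▸ hw)
  · right
    rw [hveq] at hv
    exact htop ((V.smul_mem_iff hc).1 hv)
end
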